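/- Suppose every buyer has a complementary CES utility with −∞ < ρ_i < 0 (no Leontief utilities) and all buyers repeatedly update by the rule b_ij^{t+1} = e_i · (a_ij / p_j(b^t)^{ρ_i})^{1/(1−ρ_i)} / Σ_k (a_ik / p_k(b^t)^{ρ_i})^{1/(1−ρ_i)}, starting from an entrywise positive feasible b^0. Let σ = min_i 1/(1−ρ_i) and let b* be a maximizer of Φ over the feasible set. Then for all T ≥ 1: Φ(b*) − Φ(b^T) ≤ ( σ(1−σ)^T / (1 − (1−σ)^T) ) · Σ_i ((ρ_i−1)/ρ_i)·KL(b_i* ‖ b_i^0). -/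

import Mathlib

open Finset

/-- Price of good `j` given spending `b`. -/
noncomputable def price {m n : ℕ} (b : Fin m → Fin n → ℝ) (j : Fin n) : ℝ :=
  ∑ i, b i j

/-- KL divergence between two nonnegative vectors. -/
noncomputable def KL {n : ℕ} (x y : Fin n → ℝ) : ℝ :=
  ∑ j, x j * Real.log (x j / y j)

/-- Feasible spending: nonnegative entries, each buyer spends exactly her budget. -/
def Feasible {m n : ℕ} (e : Fin m → ℝ) (b : Fin m → Fin n → ℝ) : Prop :=
  ∀ i, (∀ j, 0 ≤ b i j) ∧ ∑ j, b i j = e i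

/-- The potential function `Φ` for CES substitutes buyers. -/
noncomputable def Phi {m n : ℕ} (a : Fin m → Fin n → ℝ) (ρ : Fin m → ℝ)
    (b : Fin m → Fin n → ℝ) : ℝ :=
  -∑ i, (1 / ρ i) * ∑ j, b i j * Real.log (a i j * b i j ^ (ρ i - 1) / price b j ^ ρ i)

/-- Tangent-line bound for `t * log t`. -/
lemma sub_le_mul_log_div {x y : ℝ} (hx : 0 ≤ x) (hy : 0 < y) : x - y ≤ x * Real.log (x / y) := by
  rcases hx.eq_or_lt with rfl | hx
  · simp [hy.le]
  · have h := Real.one_sub_inv_le_log_of_pos (div_pos hx hy)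
    calc x - y = x * (1 - (x / y)⁻¹) := by field_simp
      _ ≤ _ := mul_le_mul_of_nonneg_left h hx.le

lemma KL_nonneg_of_sum_eq {n : ℕ} {x y : Fin n → ℝ} (hx : ∀ j, 0 ≤ x j) (hy : ∀ j, 0 < y j)
    (h : ∑ j, x j = ∑ j, y j) : 0 ≤ KL x y :=
  calc (0 : ℝ) = ∑ j, (x j - y j) := by rw [sum_sub_distrib, h, sub_self]
    _ ≤ KL x y := sum_le_sum fun j _ => sub_le_mul_log_div (hx j) (hy j)

lemma KL_self {n : ℕ} (x : Fin n → ℝ) : KL x x = 0 := by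
  refine sum_eq_zero fun j _ => ?_
  by_cases h : x j = 0 <;> simp [h]

lemma sum_price {m n : ℕ} {e : Fin m → ℝ} {x : Fin m → Fin n → ℝ} (hx : Feasible e x) :
    ∑ j, price x j = ∑ i, e i := by
  unfold price
  rw [sum_comm]
  exact sum_congr rfl fun i _ => (hx i).2

lemma price_nonneg {m n : ℕ} {e : Fin m → ℝ} {x : Fin m → Fin n → ℝ} (hx : Feasible e x)
    (j : Fin n) : 0 ≤ price x j :=
  sum_nonneg fun i _ => (hx i).1 j

lemma KL_price {m n : ℕ} (x : Fin m → Fin n → ℝ) (q : Fin n → ℝ) :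
    KL (price x) q = ∑ i, ∑ j, x i j * Real.log (price x j / q j) := by
  rw [sum_comm, KL]
  exact sum_congr rfl fun j _ => by rw [← sum_mul]; rfl

/-- The log-sum inequality: aggregating over buyers does not increase the divergence. -/
lemma KL_price_le_sum {m n : ℕ} [Nonempty (Fin m)] {x y : Fin m → Fin n → ℝ}
    (hx : ∀ i j, 0 ≤ x i j) (hy : ∀ i j, 0 < y i j) :
    KL (price x) (price y) ≤ ∑ i, KL (x i) (y i) := by
  rw [KL_price, sum_comm]
  unfold KL
  rw [sum_comm (s := (univ : Finset (Fin m)))]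
  refine sum_le_sum fun j _ => ?_
  have hq : 0 < price y j := sum_pos (fun i _ => hy i j) univ_nonempty
  have key : ∀ i, x i j - y i j * (price x j / price y j) ≤
      x i j * Real.log (x i j / y i j) - x i j * Real.log (price x j / price y j) := by
    intro i
    rcases (hx i j).eq_or_lt with h0 | h0
    · have hp : 0 ≤ price x j := sum_nonneg fun i _ => hx i j
      have := mul_nonneg (hy i j).le (div_nonneg hp hq.le)
      simpa [← h0] using this
    · have hp : 0 < price x j := sum_pos' (fun i _ => hx i j) ⟨i, mem_univ i, h0⟩
      have h := sub_le_mul_log_div h0.le (mul_pos (hy i j) (div_pos hp hq))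
      rwa [← div_div, Real.log_div (div_pos h0 (hy i j)).ne' (div_pos hp hq).ne', mul_sub] at h
  have h := sum_le_sum fun i (_ : i ∈ univ) => key i
  rw [sum_sub_distrib, sum_sub_distrib, ← sum_mul] at h
  have h1 : (∑ i, y i j) * (price x j / price y j) = ∑ i, x i j := by
    change price y j * (price x j / price y j) = price x j
    field_simp
  linarith

/-- The weighted divergence with respect to which proportional response is mirror descent. -/
noncomputable def weightedKL {m n : ℕ} (ρ : Fin m → ℝ) (x y : Fin m → Fin n → ℝ) : ℝ :=
  ∑ i, ((ρ i - 1) / ρ i) * KL (x i) (y i)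

lemma weightedKL_nonneg {m n : ℕ} {e ρ : Fin m → ℝ} {x y : Fin m → Fin n → ℝ}
    (hρ : ∀ i, ρ i < 0) (hx : Feasible e x) (hy : Feasible e y) (hypos : ∀ i j, 0 < y i j) :
    0 ≤ weightedKL ρ x y := by
  refine sum_nonneg fun i _ => mul_nonneg ?_ ?_
  · exact div_nonneg_of_nonpos (by linarith [hρ i]) (hρ i).le
  · exact KL_nonneg_of_sum_eq (hx i).1 (hypos i) ((hx i).2.trans (hy i).2.symm)

lemma weightedKL_self {m n : ℕ} (ρ : Fin m → ℝ) (x : Fin m → Fin n → ℝ) :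
    weightedKL ρ x x = 0 := by
  simp [weightedKL, KL_self]

lemma KL_price_le_weightedKL {m n : ℕ} [Nonempty (Fin m)] {e ρ : Fin m → ℝ}
    {x y : Fin m → Fin n → ℝ} (hρ : ∀ i, ρ i < 0) (hx : Feasible e x) (hy : Feasible e y)
    (hypos : ∀ i j, 0 < y i j) {σ : ℝ} (hσ : ∀ i, σ ≤ 1 / (1 - ρ i)) :
    KL (price x) (price y) ≤ (1 - σ) * weightedKL ρ x y := by
  refine (KL_price_le_sum (fun i => (hx i).1) hypos).trans ?_
  rw [weightedKL, mul_sum]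
  refine sum_le_sum fun i _ => ?_
  have hK := KL_nonneg_of_sum_eq (hx i).1 (hypos i) ((hx i).2.trans (hy i).2.symm)
  have hi := hρ i
  have hne : 1 - ρ i ≠ 0 := by linarith
  have hne' : ρ i - 1 ≠ 0 := by linarith
  have hc : 0 ≤ (ρ i - 1) / ρ i := div_nonneg_of_nonpos (by linarith) hi.le
  have h1 : (1 - 1 / (1 - ρ i)) * ((ρ i - 1) / ρ i) = 1 := by
    field_simp [hi.ne]
    ring
  have h2 : 1 ≤ (1 - σ) * ((ρ i - 1) / ρ i) :=
    h1.symm.le.trans (mul_le_mul_of_nonneg_right (by linarith [hσ i]) hc)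
  nlinarith

/-- If `y` is the proportional response to prices `q`, with normalizing constants `K`, then `-Φ`
differs by a constant from a difference of divergences. -/
lemma neg_Phi_eq {m n : ℕ} {e ρ : Fin m → ℝ} {a x y : Fin m → Fin n → ℝ} {q : Fin n → ℝ}
    (K : Fin m → ℝ) (hρ : ∀ i, ρ i < 0) (ha : ∀ i j, 0 < a i j) (hx : Feasible e x)
    (hy : ∀ i j, 0 < y i j) (hq : ∀ j, 0 < q j)
    (hlog : ∀ i j, (ρ i - 1) / ρ i * Real.log (y i j) =
      K i - 1 / ρ i * Real.log (a i j) + Real.log (q j)) :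
    -Phi a ρ x = weightedKL ρ x y + ∑ i, K i * e i - KL (price x) q := by
  rw [Phi, neg_neg, weightedKL, KL_price, ← sum_add_distrib, ← sum_sub_distrib]
  refine sum_congr rfl fun i _ => ?_
  rw [← (hx i).2, KL, mul_sum, mul_sum, mul_sum, ← sum_add_distrib, ← sum_sub_distrib]
  refine sum_congr rfl fun j _ => ?_
  rcases ((hx i).1 j).eq_or_lt with h0 | h0
  · simp [← h0]
  · have hp : 0 < price x j := sum_pos' (fun i _ => (hx i).1 j) ⟨i, mem_univ i, h0⟩
    have hxp := Real.rpow_pos_of_pos h0 (ρ i - 1)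
    have hpp := Real.rpow_pos_of_pos hp (ρ i)
    rw [Real.log_div (mul_pos (ha i j) hxp).ne' hpp.ne', Real.log_mul (ha i j).ne' hxp.ne',
      Real.log_rpow h0, Real.log_rpow hp, Real.log_div h0.ne' (hy i j).ne',
      Real.log_div hp.ne' (hq j).ne']
    have h2 : 1 / ρ i * ρ i = 1 := one_div_mul_cancel (hρ i).ne
    linear_combination x i j * hlog i j - x i j * Real.log (price x j) * h2

/-- One-step bounds of the form of relatively smooth, relatively strongly convex mirror descent
give linear convergence of the gap `δ`. -/
lemma gap_le_of_descent {r : ℝ} (hr0 : 0 < r) (hr1 : r < 1) {δ D : ℕ → ℝ} (hD : ∀ t, 0 ≤ D t)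
    (hδ : ∀ t, δ (t + 1) ≤ δ t) (hstep : ∀ t, δ (t + 1) ≤ r * D t - D (t + 1))
    {T : ℕ} (hT : 1 ≤ T) : δ T ≤ (1 - r) * r ^ T / (1 - r ^ T) * D 0 := by
  have key : ∀ t, δ t * (1 - r ^ t) + (1 - r) * D t ≤ (1 - r) * r ^ t * D 0 := by
    intro t
    induction t with
    | zero => simp
    | succ t ih =>
      have hrt : 0 ≤ 1 - r ^ t := sub_nonneg.2 (pow_le_one₀ hr0.le hr1.le)
      have h1 := mul_le_mul_of_nonneg_left (hδ t) (mul_nonneg hr0.le hrt)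
      have h2 := mul_le_mul_of_nonneg_left (hstep t) (sub_pos.2 hr1).le
      have h3 := mul_le_mul_of_nonneg_left ih hr0.le
      rw [pow_succ]
      linarith
  have hpos : 0 < 1 - r ^ T := sub_pos.2 (pow_lt_one₀ hr0.le hr1 (by omega))
  rw [div_mul_eq_mul_div, le_div_iff₀ hpos]
  linarith [key T, mul_nonneg (sub_pos.2 hr1).le (hD T)]

/-- The complementary proportional response of a buyer to prices `q`. -/
lemma proportional_response_spec {n : ℕ} [Nonempty (Fin n)] {e ρ : ℝ} {a q y : Fin n → ℝ}
    (he : 0 < e) (hρ : ρ < 0) (ha : ∀ j, 0 < a j) (hq : ∀ j, 0 < q j)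
    (hy : ∀ j, y j = e * (a j / q j ^ ρ) ^ (1 / (1 - ρ)) /
      ∑ k, (a k / q k ^ ρ) ^ (1 / (1 - ρ))) :
    (∀ j, 0 < y j) ∧ ∑ j, y j = e ∧ ∃ K : ℝ, ∀ j,
      (ρ - 1) / ρ * Real.log (y j) = K - 1 / ρ * Real.log (a j) + Real.log (q j) := by
  have hqr : ∀ j, 0 < q j ^ ρ := fun j => Real.rpow_pos_of_pos (hq j) ρ
  have hw : ∀ j, 0 < (a j / q j ^ ρ) ^ (1 / (1 - ρ)) := fun j =>
    Real.rpow_pos_of_pos (div_pos (ha j) (hqr j)) _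
  have hW : 0 < ∑ k, (a k / q k ^ ρ) ^ (1 / (1 - ρ)) := sum_pos (fun j _ => hw j) univ_nonempty
  refine ⟨fun j => ?_, ?_,
    (ρ - 1) / ρ * (Real.log e - Real.log (∑ k, (a k / q k ^ ρ) ^ (1 / (1 - ρ)))), fun j => ?_⟩
  · rw [hy]
    exact div_pos (mul_pos he (hw j)) hW
  · simp_rw [hy]
    rw [← sum_div, ← mul_sum, mul_div_cancel_right₀ _ hW.ne']
  · have hne : 1 - ρ ≠ 0 := by linarith
    rw [hy, Real.log_div (mul_pos he (hw j)).ne' hW.ne', Real.log_mul he.ne' (hw j).ne',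
      Real.log_rpow (div_pos (ha j) (hqr j)), Real.log_div (ha j).ne' (hqr j).ne',
      Real.log_rpow (hq j)]
    have h1 : (ρ - 1) / ρ * (1 / (1 - ρ)) = -(1 / ρ) := by
      field_simp [hρ.ne]
      ring
    have h2 : 1 / ρ * ρ = 1 := one_div_mul_cancel hρ.ne
    linear_combination (Real.log (a j) - ρ * Real.log (q j)) * h1 + Real.log (q j) * h2

/-- Linear convergence of Proportional Response in the strict CES
complements domain `-∞ < ρ_i < 0`, with `σ = min_i 1/(1-ρ_i)`. -/
theorem proportional_response_complements_linear {m n : ℕ}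
    (e : Fin m → ℝ) (he : ∀ i, 0 < e i)
    (a : Fin m → Fin n → ℝ) (ha : ∀ i j, 0 < a i j)
    (ρ : Fin m → ℝ) (hρ : ∀ i, ρ i < 0)
    (b : ℕ → Fin m → Fin n → ℝ)
    (hb0pos : ∀ i j, 0 < b 0 i j) (hb0 : Feasible e (b 0))
    -- the complementary Proportional Response update
    (hupd : ∀ t i j, b (t + 1) i j =
      e i * (a i j / price (b t) j ^ ρ i) ^ (1 / (1 - ρ i)) /
        ∑ k, (a i k / price (b t) k ^ ρ i) ^ (1 / (1 - ρ i)))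
    -- σ = min_i 1/(1 - ρ_i)
    (σ : ℝ) (hσle : ∀ i, σ ≤ 1 / (1 - ρ i)) (hσmem : ∃ i, σ = 1 / (1 - ρ i))
    -- b* maximizes Φ over the feasible set (equilibrium spending)
    (bstar : Fin m → Fin n → ℝ) (hbstarFeas : Feasible e bstar)
    (hbstarMax : ∀ b', Feasible e b' → Phi a ρ b' ≤ Phi a ρ bstar)
    (T : ℕ) (hT : 1 ≤ T) :
    Phi a ρ bstar - Phi a ρ (b T) ≤
      σ * (1 - σ) ^ T / (1 - (1 - σ) ^ T) *
        ∑ i, ((ρ i - 1) / ρ i) * KL (bstar i) (b 0 i) := by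
  obtain ⟨i₀, hi₀⟩ := hσmem
  have : Nonempty (Fin m) := ⟨i₀⟩
  have : Nonempty (Fin n) := by
    by_contra h
    rw [not_nonempty_iff] at h
    have h0 := (hb0 i₀).2
    rw [univ_eq_empty, sum_empty] at h0
    exact (he i₀).ne h0
  have hppos : ∀ {x : Fin m → Fin n → ℝ}, (∀ i j, 0 < x i j) → ∀ j, 0 < price x j :=
    fun hx j => sum_pos (fun i _ => hx i j) univ_nonempty
  have hspec := fun t (h : ∀ i j, 0 < b t i j) i =>
    proportional_response_spec (he i) (hρ i) (ha i) (hppos h) (hupd t i)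
  have hpos : ∀ t i j, 0 < b t i j := by
    intro t
    induction t with
    | zero => exact hb0pos
    | succ t ih => exact fun i => (hspec t ih i).1
  have hfeas : ∀ t, Feasible e (b t) := by
    intro t
    cases t with
    | zero => exact hb0
    | succ t => exact fun i => ⟨fun j => (hpos _ i j).le, (hspec t (hpos t) i).2.1⟩
  have hdescent : ∀ t x, Feasible e x →
      -Phi a ρ (b (t + 1)) ≤
        -Phi a ρ x + KL (price x) (price (b t)) - weightedKL ρ x (b (t + 1)) := by
    intro t x hx
    choose K hK using fun i => (hspec t (hpos t) i).2.2
    rw [neg_Phi_eq K hρ ha hx (hpos (t + 1)) (hppos (hpos t)) hK,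
      neg_Phi_eq K hρ ha (hfeas (t + 1)) (hpos (t + 1)) (hppos (hpos t)) hK, weightedKL_self]
    have h := KL_nonneg_of_sum_eq (price_nonneg (hfeas (t + 1))) (hppos (hpos t))
      ((sum_price (hfeas (t + 1))).trans (sum_price (hfeas t)).symm)
    linarith
  have hσ0 : 0 < σ := hi₀ ▸ one_div_pos.2 (by linarith [hρ i₀])
  have hσ1 : σ < 1 := by
    rw [hi₀, div_lt_one (by linarith [hρ i₀])]
    linarith [hρ i₀]
  have hD : ∀ x, Feasible e x → ∀ t, 0 ≤ weightedKL ρ x (b t) := fun x hx t =>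
    weightedKL_nonneg hρ hx (hfeas t) (hpos t)
  have main := gap_le_of_descent (r := 1 - σ) (by linarith) (by linarith)
    (δ := fun t => Phi a ρ bstar - Phi a ρ (b t)) (D := fun t => weightedKL ρ bstar (b t))
    (hD bstar hbstarFeas)
    (fun t => by
      have h1 := hdescent t (b t) (hfeas t)
      rw [KL_self] at h1
      linarith [hD (b t) (hfeas t) (t + 1)])
    (fun t => by
      have h1 := hdescent t bstar hbstarFeas
      have h2 := KL_price_le_weightedKL hρ hbstarFeas (hfeas t) (hpos t) hσle
      linarith) hT
  rwa [sub_sub_cancel] at main
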